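/- With p_c := inf{ p ∈ [0,1] : lim_{n→∞} T_n(p) = 1 }, for every p ∈ [0,1]: if p < p_c then lim_{n→∞} T_n(p) = 0, and if p > p_c then lim_{n→∞} T_n(p) = 1. -/

import Mathlib

open Set Filter Topology

noncomputable section

/-- The dyadic tile `[a/2^i, (a+1)/2^i] × [b/2^j, (b+1)/2^j]` as a subset of `ℝ × ℝ`. -/
def dyadicTile (i j a b : ℕ) : Set (ℝ × ℝ) :=
  Set.Icc ((a : ℝ) / 2 ^ i) (((a : ℝ) + 1) / 2 ^ i) ×ˢ
    Set.Icc ((b : ℝ) / 2 ^ j) (((b : ℝ) + 1) / 2 ^ j)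

/-- `t` is a dyadic tile of order `n` contained in the unit square. -/
def IsDyadicTile (n : ℕ) (t : Set (ℝ × ℝ)) : Prop :=
  ∃ i j a b : ℕ, i + j = n ∧ a < 2 ^ i ∧ b < 2 ^ j ∧ t = dyadicTile i j a b

/-- `F` is a tiling of the region `R` by dyadic tiles of order `n`:
a set of order-`n` tiles whose union is `R` and whose interiors are pairwise disjoint. -/
def IsTiling (n : ℕ) (F : Set (Set (ℝ × ℝ))) (R : Set (ℝ × ℝ)) : Prop :=
  (∀ t ∈ F, IsDyadicTile n t) ∧ ⋃₀ F = R ∧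
    F.Pairwise fun s t => interior s ∩ interior t = ∅

def unitSquare : Set (ℝ × ℝ) := Set.Icc (0 : ℝ) 1 ×ˢ Set.Icc (0 : ℝ) 1

/-- Index type for the dyadic tiles of order `n`: a shape `i` (width `2^{-i}`, height
`2^{-(n-i)}`) together with the horizontal and vertical positions. -/
abbrev TileIndex (n : ℕ) : Type :=
  Σ i : Fin (n + 1), Fin (2 ^ (i : ℕ)) × Fin (2 ^ (n - (i : ℕ)))

/-- The order-`n` tile corresponding to an index. -/
def tileOf (n : ℕ) (x : TileIndex n) : Set (ℝ × ℝ) :=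
  dyadicTile (x.1 : ℕ) (n - (x.1 : ℕ)) (x.2.1 : ℕ) (x.2.2 : ℕ)

/-- The set `S` of available order-`n` tiles admits a tiling of the unit square. -/
def TileableSquare (n : ℕ) (S : Finset (TileIndex n)) : Prop :=
  ∃ F : Set (Set (ℝ × ℝ)), (∀ t ∈ F, ∃ x ∈ S, t = tileOf n x) ∧ IsTiling n F unitSquare

open Classical in
/-- Probability of the event `E` when each of the `(n+1)·2^n` order-`n` dyadic tiles is
available independently with probability `p`. -/
def Pr (n : ℕ) (p : ℝ) (E : Finset (TileIndex n) → Prop) : ℝ :=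
  ∑ S : Finset (TileIndex n),
    if E S then p ^ S.card * (1 - p) ^ ((n + 1) * 2 ^ n - S.card) else 0

/-- `T n p`: the probability that some set of available order-`n` tiles tiles `[0,1]²`. -/
def T (n : ℕ) (p : ℝ) : ℝ := Pr n p (TileableSquare n)

/-- The critical probability `p_c`. -/
def pc : ℝ :=
  sInf {p : ℝ | p ∈ Set.Icc (0 : ℝ) 1 ∧ Tendsto (fun n => T n p) atTop (𝓝 1)}


namespace RandomSubset

variable {ι κ : Type*}

/-- Expectation of `f S` when `S` contains each element of `ι` independently with
probability `p`. -/
def expect [Fintype ι] (p : ℝ) (f : Finset ι → ℝ) : ℝ :=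
  ∑ S : Finset ι, p ^ S.card * (1 - p) ^ (Fintype.card ι - S.card) * f S

/-- Averaging `f` over the status of the element `i`. -/
def avg [DecidableEq ι] (p : ℝ) (i : ι) (f : Finset ι → ℝ) : Finset ι → ℝ :=
  fun S => p * f (insert i S) + (1 - p) * f (S.erase i)

/-- The discrete derivative of `f` in the direction `i`. -/
def diff [DecidableEq ι] (i : ι) (f : Finset ι → ℝ) : Finset ι → ℝ :=
  fun S => f (insert i S) - f (S.erase i)

/-- Averaging over the status of all the elements of a list. -/
def avgList [DecidableEq ι] (p : ℝ) (l : List ι) (f : Finset ι → ℝ) : Finset ι → ℝ :=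
  l.foldl (fun g i => avg p i g) f

@[simp] lemma avgList_nil [DecidableEq ι] (p : ℝ) (f : Finset ι → ℝ) : avgList p [] f = f := rfl

@[simp] lemma avgList_cons [DecidableEq ι] (p : ℝ) (i : ι) (l : List ι) (f : Finset ι → ℝ) :
    avgList p (i :: l) f = avgList p l (avg p i f) := rfl

section Expect

variable [Fintype ι] [Fintype κ] {p : ℝ} {f g : Finset ι → ℝ}

lemma expect_add (p : ℝ) (f g : Finset ι → ℝ) :
    expect p (fun S => f S + g S) = expect p f + expect p g := by
  simp only [expect, mul_add, Finset.sum_add_distrib]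

lemma expect_sub (p : ℝ) (f g : Finset ι → ℝ) :
    expect p (fun S => f S - g S) = expect p f - expect p g := by
  simp only [expect, mul_sub, Finset.sum_sub_distrib]

lemma expect_const_mul (p c : ℝ) (f : Finset ι → ℝ) :
    expect p (fun S => c * f S) = c * expect p f := by
  simp only [expect, Finset.mul_sum]
  exact Finset.sum_congr rfl fun S _ => by ring

lemma expect_const (p c : ℝ) : expect p (fun _ : Finset ι => c) = c := by
  have h := Fintype.sum_pow_mul_eq_add_pow ι p (1 - p)
  simp only [expect, ← Finset.sum_mul, h]
  simp

lemma expect_mono (hp : p ∈ Icc (0 : ℝ) 1) (h : ∀ S, f S ≤ g S) :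
    expect p f ≤ expect p g :=
  Finset.sum_le_sum fun S _ => mul_le_mul_of_nonneg_left (h S)
    (mul_nonneg (pow_nonneg hp.1 _) (pow_nonneg (sub_nonneg.2 hp.2) _))

lemma expect_nonneg (hp : p ∈ Icc (0 : ℝ) 1) (h : ∀ S, 0 ≤ f S) : 0 ≤ expect p f := by
  simpa [expect_const] using expect_mono (f := fun _ => (0 : ℝ)) hp h

lemma expect_eq_sum_compl [DecidableEq ι] (p : ℝ) (i : ι) (f : Finset ι → ℝ) :
    expect p f = ∑ S ∈ (Finset.univ.erase i).powerset,
      p ^ S.card * (1 - p) ^ (Fintype.card ι - (S.card + 1)) *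
        (p * f (insert i S) + (1 - p) * f S) := by
  have h : (Finset.univ : Finset (Finset ι)) = (insert i (Finset.univ.erase i)).powerset := by
    rw [Finset.insert_erase (Finset.mem_univ i), Finset.powerset_univ]
  rw [expect, h, Finset.sum_powerset_insert (Finset.notMem_erase i _), ← Finset.sum_add_distrib]
  refine Finset.sum_congr rfl fun S hS => ?_
  have hi : i ∉ S := fun hi => Finset.notMem_erase i _ (Finset.mem_powerset.1 hS hi)
  have hc : Fintype.card ι - S.card = (Fintype.card ι - (S.card + 1)) + 1 := by
    have : (insert i S).card ≤ Fintype.card ι := Finset.card_le_univ _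
    rw [Finset.card_insert_of_notMem hi] at this
    omega
  rw [Finset.card_insert_of_notMem hi, hc]
  ring

lemma expect_avg [DecidableEq ι] (p : ℝ) (i : ι) (f : Finset ι → ℝ) :
    expect p (avg p i f) = expect p f := by
  rw [expect_eq_sum_compl p i, expect_eq_sum_compl p i f]
  refine Finset.sum_congr rfl fun S hS => ?_
  have hi : i ∉ S := fun hi => Finset.notMem_erase i _ (Finset.mem_powerset.1 hS hi)
  simp only [avg, Finset.insert_idem, Finset.erase_insert hi, Finset.erase_eq_of_notMem hi]
  ring

lemma expect_avgList [DecidableEq ι] (p : ℝ) (l : List ι) (f : Finset ι → ℝ) :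
    expect p (avgList p l f) = expect p f := by
  induction l generalizing f with
  | nil => rfl
  | cons i l ih => rw [avgList_cons, ih, expect_avg]

/-- Invariance of the expectation under relabelling. -/
lemma expect_equiv (p : ℝ) (e : ι ≃ κ) (f : Finset κ → ℝ) :
    expect p (fun S : Finset ι => f (S.map e.toEmbedding)) = expect p f := by
  refine Fintype.sum_equiv (Equiv.finsetCongr e) _ _ fun S => ?_
  simp [Equiv.finsetCongr_apply, Fintype.card_congr e]

/-- Fubini for the random subset of a disjoint union. -/
lemma expect_sum_type (p : ℝ) (f : Finset (ι ⊕ κ) → ℝ) :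
    expect p f = expect p fun S : Finset ι => expect p fun R : Finset κ => f (S.disjSum R) := by
  simp only [expect, Finset.mul_sum]
  rw [← Fintype.sum_prod_type', ← (Finset.sumEquiv (α := ι) (β := κ)).symm.toEquiv.sum_comp]
  refine Finset.sum_congr rfl fun x _ => ?_
  have h1 : x.1.card ≤ Fintype.card ι := Finset.card_le_univ _
  have h2 : x.2.card ≤ Fintype.card κ := Finset.card_le_univ _
  have h3 : Fintype.card ι + Fintype.card κ - (x.1.card + x.2.card) =
      (Fintype.card ι - x.1.card) + (Fintype.card κ - x.2.card) := by omega
  have h4 : (Finset.sumEquiv (α := ι) (β := κ)).symm.toEquiv x = x.1.disjSum x.2 := rfl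
  simp only [h4, Finset.card_disjSum, Fintype.card_sum, h3, pow_add]
  ring

/-- Functions of the restrictions of a random subset to disjoint sets are independent. -/
lemma expect_mul_of_disjoint [DecidableEq κ] (p : ℝ) (e : ι ⊕ ι → κ) (he : Function.Injective e)
    (f g : Finset ι → ℝ) :
    expect p (fun S : Finset κ => f {a | e (.inl a) ∈ S} * g {a | e (.inr a) ∈ S}) =
      expect p f * expect p g := by
  classical
  let E : (ι ⊕ ι) ⊕ {x // x ∉ Set.range e} ≃ κ :=
    ((Equiv.ofInjective e he).sumCongr (Equiv.refl _)).trans (Equiv.Set.sumCompl (Set.range e))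
  have hE : ∀ x, E (.inl x) = e x := fun _ => rfl
  rw [← expect_equiv p E, expect_sum_type, expect_sum_type]
  have h : ∀ (S R : Finset ι) (Q : Finset {x // x ∉ Set.range e}),
      ({a | e (.inl a) ∈ ((S.disjSum R).disjSum Q).map E.toEmbedding} : Finset ι) = S ∧
      ({a | e (.inr a) ∈ ((S.disjSum R).disjSum Q).map E.toEmbedding} : Finset ι) = R := by
    intro S R Q
    constructor <;> ext a <;> simp [← hE]
  simp only [h, expect_const, expect_const_mul]
  simp only [mul_comm _ (expect p g), expect_const_mul]

end Expect

section Diff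

variable [DecidableEq ι] {p : ℝ} {f g : Finset ι → ℝ} {i j : ι}

lemma diff_avg_self (p : ℝ) (i : ι) (f : Finset ι → ℝ) : diff i (avg p i f) = 0 := by
  funext S
  have h : (insert i S).erase i = S.erase i := by ext; simp
  have h' : insert i (S.erase i) = insert i S := by ext; simp; tauto
  simp [diff, avg, h, h']

lemma diff_avg_of_ne (p : ℝ) (hij : i ≠ j) (f : Finset ι → ℝ) :
    diff i (avg p j f) = avg p j (diff i f) := by
  funext S
  simp only [diff, avg, Finset.erase_insert_of_ne hij, Finset.erase_insert_of_ne hij.symm,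
    Finset.erase_right_comm (a := i) (b := j), Finset.insert_comm i j]
  ring

lemma avg_avg_self (p : ℝ) (i : ι) (f : Finset ι → ℝ) : avg p i (avg p i f) = avg p i f := by
  funext S
  have h : (insert i S).erase i = S.erase i := by ext; simp
  have h' : insert i (S.erase i) = insert i S := by ext; simp; tauto
  simp only [avg, h, h', Finset.insert_idem, Finset.erase_idem]
  ring

lemma avg_diff_self (p : ℝ) (i : ι) (f : Finset ι → ℝ) : avg p i (diff i f) = diff i f := by
  funext S
  have h : (insert i S).erase i = S.erase i := by ext; simp
  have h' : insert i (S.erase i) = insert i S := by ext; simp; tauto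
  simp only [avg, diff, h, h', Finset.insert_idem, Finset.erase_idem]
  ring

lemma avg_mono (hp : p ∈ Icc (0 : ℝ) 1) (h : ∀ S, f S ≤ g S) (S : Finset ι) :
    avg p i f S ≤ avg p i g S :=
  add_le_add (mul_le_mul_of_nonneg_left (h _) hp.1)
    (mul_le_mul_of_nonneg_left (h _) (sub_nonneg.2 hp.2))

lemma avg_const (p c : ℝ) (i : ι) (S : Finset ι) : avg p i (fun _ => c) S = c := by
  simp only [avg]
  ring

lemma avgList_add (p : ℝ) (l : List ι) (f g : Finset ι → ℝ) :
    avgList p l (f + g) = avgList p l f + avgList p l g := by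
  induction l generalizing f g with
  | nil => rfl
  | cons i l ih =>
    rw [avgList_cons, avgList_cons, avgList_cons, ← ih]
    congr 1
    funext S
    simp only [avg, Pi.add_apply]
    ring

lemma diff_avgList_eq_zero (p : ℝ) (l : List ι) (f : Finset ι → ℝ)
    (h : i ∈ l ∨ diff i f = 0) : diff i (avgList p l f) = 0 := by
  induction l generalizing f with
  | nil => simpa using h
  | cons j l ih =>
    rw [avgList_cons]
    by_cases hij : i = j
    · subst hij
      exact ih _ (.inr (diff_avg_self p i f))
    · refine ih _ (h.imp (fun h => ?_) fun h => ?_)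
      · simpa [hij] using h
      · rw [diff_avg_of_ne p hij, h]
        funext S
        simp [avg]

lemma apply_eq_of_diff_eq_zero (h : ∀ i, diff i f = 0) (S R : Finset ι) : f S = f R := by
  have key : ∀ S, f S = f ∅ := by
    intro S
    induction S using Finset.induction_on with
    | empty => rfl
    | insert a s ha ih =>
      have := congrFun (h a) s
      simp only [diff, Finset.erase_eq_of_notMem ha, Pi.zero_apply] at this
      linarith
  rw [key S, key R]

/-- Derivative of iterated averages, when also the averaged function depends on `p`. -/
lemma hasDerivAt_avgList {l : List ι} (hl : l.Nodup) {q : ℝ} (F : ℝ → Finset ι → ℝ)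
    (F' : Finset ι → ℝ) (hF : ∀ S, HasDerivAt (fun p => F p S) (F' S) q) (S : Finset ι) :
    HasDerivAt (fun p => avgList p l (F p) S)
      ((l.map fun i => avgList q l (diff i (F q)) S).sum + avgList q l F' S) q := by
  induction l generalizing F F' with
  | nil => simpa using hF S
  | cons i l ih =>
    obtain ⟨hi, hl⟩ := List.nodup_cons.1 hl
    have hd : ∀ S, HasDerivAt (fun p => avg p i (F p) S) ((diff i (F q) + avg q i F') S) q := by
      intro S
      have := ((hasDerivAt_id q).mul (hF (insert i S))).add
        (((hasDerivAt_id q).const_sub 1).mul (hF (S.erase i)))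
      refine this.congr_deriv ?_
      simp only [diff, avg, Pi.add_apply, id]
      ring
    have := ih hl (fun p => avg p i (F p)) _ hd
    simp only [avgList_cons, List.map_cons, List.sum_cons, avg_diff_self]
    convert this using 1
    rw [avgList_add, Pi.add_apply]
    have h : (l.map fun j => avgList q l (avg q i (diff j (F q))) S) =
        l.map fun j => avgList q l (diff j (avg q i (F q))) S :=
      List.map_congr_left fun j hj => by
        rw [diff_avg_of_ne q (by rintro rfl; exact hi hj)]
    rw [h]
    ring

variable [Fintype ι]

lemma avgList_univ (p : ℝ) (f : Finset ι → ℝ) (S : Finset ι) :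
    avgList p Finset.univ.toList f S = expect p f := by
  have h : avgList p Finset.univ.toList f = fun _ => avgList p Finset.univ.toList f S :=
    funext fun R => apply_eq_of_diff_eq_zero
      (fun i => diff_avgList_eq_zero p _ f (.inl (by simp))) R S
  rw [← expect_avgList p Finset.univ.toList f, h, expect_const]

/-- Russo's formula. -/
lemma hasDerivAt_expect (f : Finset ι → ℝ) (q : ℝ) :
    HasDerivAt (fun p => expect p f) (∑ i, expect q (diff i f)) q := by
  have h := hasDerivAt_avgList (Finset.nodup_toList (Finset.univ : Finset ι)) (q := q)
    (fun _ => f) 0 (fun S => hasDerivAt_const q (f S)) ∅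
  simp only [avgList_univ] at h
  convert h using 1
  rw [Finset.sum_map_toList]
  simp [expect]

end Diff

section LogSobolev

lemma two_point_log_sobolev {p : ℝ} (hp : p ∈ Icc (0 : ℝ) 1) (a b : ℝ) :
    p * (a ^ 2 * Real.log (a ^ 2)) + (1 - p) * (b ^ 2 * Real.log (b ^ 2)) ≤
      (p * a ^ 2 + (1 - p) * b ^ 2) * Real.log (p * a ^ 2 + (1 - p) * b ^ 2) +
        2 * (a - b) ^ 2 := by
  obtain ⟨h0, h1⟩ := hp
  have hq : 0 ≤ 1 - p := sub_nonneg.2 h1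
  have ha : 0 ≤ p * a ^ 2 := by positivity
  have hb : 0 ≤ (1 - p) * b ^ 2 := by positivity
  set m := p * a ^ 2 + (1 - p) * b ^ 2 with hm
  rcases (add_nonneg ha hb).eq_or_lt with h | h
  · have ha' : p * a ^ 2 = 0 := by linarith
    have hb' : (1 - p) * b ^ 2 = 0 := by linarith
    rw [← mul_assoc, ← mul_assoc, ha', hb', hm, ← h]
    nlinarith [sq_nonneg (a - b)]
  · rw [← hm] at h
    have key : ∀ x : ℝ, 0 ≤ x → x * Real.log x ≤ x * Real.log m + x * (x / m - 1) := by
      intro x hx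
      rcases hx.eq_or_lt with rfl | hx
      · simp
      · have := Real.log_le_sub_one_of_pos (div_pos hx h)
        rw [Real.log_div hx.ne' h.ne'] at this
        nlinarith
    have hA := mul_le_mul_of_nonneg_left (key (a ^ 2) (sq_nonneg a)) h0
    have hB := mul_le_mul_of_nonneg_left (key (b ^ 2) (sq_nonneg b)) hq
    have hvar : p * (a ^ 2 * (a ^ 2 / m - 1)) + (1 - p) * (b ^ 2 * (b ^ 2 / m - 1)) ≤
        2 * (a - b) ^ 2 := by
      have : p * (a ^ 2 * (a ^ 2 / m - 1)) + (1 - p) * (b ^ 2 * (b ^ 2 / m - 1)) =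
          (p * (1 - p) * (a + b) ^ 2) * (a - b) ^ 2 / m := by
        field_simp
        rw [hm]
        ring
      rw [this, div_le_iff₀ h]
      have h2 : p * (1 - p) * (a + b) ^ 2 ≤ 2 * m := by
        have e1 : p * (1 - p) * (a + b) ^ 2 ≤ p * (1 - p) * (2 * (a ^ 2 + b ^ 2)) :=
          mul_le_mul_of_nonneg_left (by nlinarith [sq_nonneg (a - b)]) (mul_nonneg h0 hq)
        have e2 : 0 ≤ p * (p * a ^ 2) := mul_nonneg h0 ha
        have e3 : 0 ≤ (1 - p) * ((1 - p) * b ^ 2) := mul_nonneg hq hb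
        rw [hm]
        nlinarith
      nlinarith [mul_le_mul_of_nonneg_right h2 (sq_nonneg (a - b))]
    calc _ ≤ _ := add_le_add hA hB
      _ = m * Real.log m +
          (p * (a ^ 2 * (a ^ 2 / m - 1)) + (1 - p) * (b ^ 2 * (b ^ 2 / m - 1))) := by
        rw [hm]; ring
      _ ≤ _ := by linarith

lemma sqrt_sub_sqrt_sq_le {p : ℝ} (hp : p ∈ Icc (0 : ℝ) 1) (u v u' v' : ℝ) :
    (√(p * u ^ 2 + (1 - p) * v ^ 2) - √(p * u' ^ 2 + (1 - p) * v' ^ 2)) ^ 2 ≤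
      p * (u - u') ^ 2 + (1 - p) * (v - v') ^ 2 := by
  obtain ⟨h0, h1⟩ := hp
  have hq : 0 ≤ 1 - p := sub_nonneg.2 h1
  have hX : 0 ≤ p * u ^ 2 + (1 - p) * v ^ 2 := by positivity
  have hY : 0 ≤ p * u' ^ 2 + (1 - p) * v' ^ 2 := by positivity
  have hCS : p * (u * u') + (1 - p) * (v * v') ≤
      √(p * u ^ 2 + (1 - p) * v ^ 2) * √(p * u' ^ 2 + (1 - p) * v' ^ 2) := by
    rw [← Real.sqrt_mul hX]
    refine Real.le_sqrt_of_sq_le ?_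
    nlinarith [mul_nonneg (mul_nonneg h0 hq) (sq_nonneg (u * v' - v * u'))]
  rw [sub_sq, Real.sq_sqrt hX, Real.sq_sqrt hY]
  nlinarith

variable [DecidableEq ι] {p : ℝ}

lemma sq_diff_sqrt_avg_le (hp : p ∈ Icc (0 : ℝ) 1) (i j : ι) (g : Finset ι → ℝ)
    (S : Finset ι) :
    (diff j (fun R => √(avg p i (fun Q => g Q ^ 2) R)) S) ^ 2 ≤
      avg p i (fun R => diff j g R ^ 2) S := by
  by_cases hij : j = i
  · subst hij
    have h := congrFun (diff_avg_self p j (fun Q => g Q ^ 2)) S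
    simp only [diff, Pi.zero_apply, sub_eq_zero] at h
    have h0 := avg_mono (i := j) (f := fun _ => 0) (g := fun R => diff j g R ^ 2) hp
      (fun R => sq_nonneg _) S
    rw [avg_const] at h0
    simpa only [diff, h, sub_self, ne_eq, OfNat.ofNat_ne_zero, not_false_eq_true, zero_pow]
      using h0
  · have := sqrt_sub_sqrt_sq_le hp (g (insert j (insert i S))) (g (insert j (S.erase i)))
      (g ((insert i S).erase j)) (g ((S.erase i).erase j))
    simpa only [diff, avg, Finset.erase_insert_of_ne hij, Finset.erase_insert_of_ne (Ne.symm hij),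
      Finset.erase_right_comm (a := i) (b := j), Finset.insert_comm i j] using this

variable [Fintype ι]

lemma log_sobolev_list (hp : p ∈ Icc (0 : ℝ) 1) (l : List ι) (g : Finset ι → ℝ) :
    expect p (fun S => g S ^ 2 * Real.log (g S ^ 2)) ≤
      expect p (fun S => avgList p l (fun R => g R ^ 2) S *
        Real.log (avgList p l (fun R => g R ^ 2) S)) +
      2 * (l.map fun i => expect p fun S => diff i g S ^ 2).sum := by
  induction l generalizing g with
  | nil => simp
  | cons i l ih =>
    have hnn : ∀ S, 0 ≤ avg p i (fun R => g R ^ 2) S := fun S => by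
      have := avg_mono (i := i) (f := fun _ => 0) (g := fun R => g R ^ 2) hp
        (fun R => sq_nonneg _) S
      rwa [avg_const] at this
    have hsq : ∀ S, √(avg p i (fun R => g R ^ 2) S) ^ 2 = avg p i (fun R => g R ^ 2) S :=
      fun S => Real.sq_sqrt (hnn S)
    have h1 : expect p (fun S => g S ^ 2 * Real.log (g S ^ 2)) ≤
        expect p (fun S => avg p i (fun R => g R ^ 2) S *
          Real.log (avg p i (fun R => g R ^ 2) S)) + 2 * expect p (fun S => diff i g S ^ 2) := by
      rw [← expect_avg p i, ← expect_const_mul, ← expect_add]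
      exact expect_mono hp fun S => two_point_log_sobolev hp _ _
    have h2 := ih fun S => √(avg p i (fun R => g R ^ 2) S)
    simp only [hsq] at h2
    have h3 : (l.map fun j => expect p fun S =>
        diff j (fun S => √(avg p i (fun R => g R ^ 2) S)) S ^ 2).sum ≤
        (l.map fun j => expect p fun S => diff j g S ^ 2).sum := by
      refine List.sum_le_sum fun j _ => ?_
      rw [← expect_avg p i (fun S => diff j g S ^ 2)]
      exact expect_mono hp fun S => sq_diff_sqrt_avg_le hp i j g S
    simp only [avgList_cons, List.map_cons, List.sum_cons]
    linarith

/-- The logarithmic Sobolev inequality for a random subset. -/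
lemma log_sobolev (hp : p ∈ Icc (0 : ℝ) 1) (g : Finset ι → ℝ) :
    expect p (fun S => g S ^ 2 * Real.log (g S ^ 2)) ≤
      expect p (fun S => g S ^ 2) * Real.log (expect p fun S => g S ^ 2) +
      2 * ∑ i, expect p fun S => diff i g S ^ 2 := by
  have h := log_sobolev_list hp Finset.univ.toList g
  simpa only [avgList_univ, expect_const, Finset.sum_map_toList] using h

/-- Functions with small first moment have large entropy, hence large energy. -/
lemma energy_ge_of_abs_small (hp : p ∈ Icc (0 : ℝ) 1) {s : ℝ} (hs : 0 < s)
    (d : Finset ι → ℝ) (hd1 : ∀ S, |d S| ≤ 1) (hd : expect p (fun S => |d S|) ≤ s ^ 4) :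
    -2 * Real.log s * expect p (fun S => d S ^ 2) ≤
      2 * ∑ i, expect p (fun S => diff i d S ^ 2) + 2 * s * expect p (fun S => |d S|) := by
  have hsob := log_sobolev hp d
  set x := expect p fun S => d S ^ 2 with hx
  have hx0 : 0 ≤ x := expect_nonneg hp fun S => sq_nonneg _
  have hxs : x ≤ s ^ 4 := (expect_mono hp fun S => by
    rw [← sq_abs]; nlinarith [hd1 S, abs_nonneg (d S)]).trans hd
  have hxlog : x * Real.log x ≤ 4 * (x * Real.log s) := by
    rcases hx0.eq_or_lt with h | h
    · simp [← h]
    · have := Real.log_le_log h hxs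
      rw [Real.log_pow] at this
      push_cast at this
      nlinarith
  have hlow : 2 * (x * Real.log s) + 2 * x - 2 * s * expect p (fun S => |d S|) ≤
      expect p (fun S => d S ^ 2 * Real.log (d S ^ 2)) := by
    have : 2 * (x * Real.log s) + 2 * x - 2 * s * expect p (fun S => |d S|) =
        expect p fun S => (2 * Real.log s + 2) * d S ^ 2 - (2 * s) * |d S| := by
      rw [expect_sub, expect_const_mul, expect_const_mul]
      ring
    rw [this]
    refine expect_mono hp fun S => ?_
    rcases eq_or_ne (d S) 0 with h | h
    · simp [h]
    · have ha : 0 < |d S| := abs_pos.2 h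
      have h1 := Real.log_le_sub_one_of_pos (div_pos hs ha)
      rw [Real.log_div hs.ne' ha.ne'] at h1
      have h2 := mul_le_mul_of_nonneg_left h1 (sq_nonneg |d S|)
      have h3 : |d S| ^ 2 * (s / |d S| - 1) = s * |d S| - |d S| ^ 2 := by
        field_simp
      rw [← sq_abs, Real.log_pow]
      push_cast
      linarith
  linarith

end LogSobolev

section Influence

variable [DecidableEq ι] {p : ℝ}

lemma abs_sub_avg_le (hp : p ∈ Icc (0 : ℝ) 1) (i : ι) (f : Finset ι → ℝ) (S : Finset ι) :
    |f S - avg p i f S| ≤ |diff i f S| := by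
  have hp1 : |p| ≤ 1 := by rw [abs_of_nonneg hp.1]; exact hp.2
  have hq1 : |1 - p| ≤ 1 := by rw [abs_of_nonneg (sub_nonneg.2 hp.2)]; linarith [hp.1]
  by_cases hi : i ∈ S
  · have : f S - avg p i f S = (1 - p) * diff i f S := by
      simp only [avg, diff, Finset.insert_eq_self.2 hi]
      ring
    rw [this, abs_mul]
    exact mul_le_of_le_one_left (abs_nonneg _) hq1
  · have : f S - avg p i f S = -p * diff i f S := by
      simp only [avg, diff, Finset.erase_eq_of_notMem hi]
      ring
    rw [this, abs_mul, abs_neg]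
    exact mul_le_of_le_one_left (abs_nonneg _) hp1

variable [Fintype ι]

lemma expect_mul_sub_avg (p : ℝ) (i : ι) (f : Finset ι → ℝ) :
    expect p (fun S => avg p i f S * (f S - avg p i f S)) = 0 := by
  rw [← expect_avg p i]
  have h : avg p i (fun S => avg p i f S * (f S - avg p i f S)) = fun _ => 0 := by
    funext S
    have h1 := congrFun (avg_avg_self p i f) S
    have h2 := congrFun (diff_avg_self p i f) S
    simp only [diff, Pi.zero_apply, sub_eq_zero] at h2
    have h3 : avg p i f S = p * f (insert i S) + (1 - p) * f (S.erase i) := rfl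
    have h4 : avg p i (avg p i f) S =
      p * avg p i f (insert i S) + (1 - p) * avg p i f (S.erase i) := rfl
    have h5 : avg p i f (S.erase i) = avg p i f S := by
      rw [h4, h2] at h1
      linarith
    simp only [avg] at *
    rw [h2]
    linear_combination
      (p * f (insert i (S.erase i)) + (1 - p) * f ((S.erase i).erase i)) * (-h5)
  rw [h, expect_const]

lemma expect_sq_eq_add (p : ℝ) (i : ι) (f : Finset ι → ℝ) :
    expect p (fun S => f S ^ 2) =
      expect p (fun S => avg p i f S ^ 2) + expect p (fun S => (f S - avg p i f S) ^ 2) := by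
  have h : (fun S => f S ^ 2) = fun S => (avg p i f S ^ 2 + (f S - avg p i f S) ^ 2) +
      2 * (avg p i f S * (f S - avg p i f S)) := by
    funext S
    ring
  rw [h, expect_add, expect_add, expect_const_mul, expect_mul_sub_avg]
  ring

lemma expect_sq_diff_eq_add (p : ℝ) (i j : ι) (f : Finset ι → ℝ) :
    expect p (fun S => diff j f S ^ 2) =
      expect p (fun S => diff j (avg p i f) S ^ 2) +
        expect p (fun S => diff j (fun R => f R - avg p i f R) S ^ 2) := by
  have hsub : ∀ S, diff j (fun R => f R - avg p i f R) S = diff j f S - diff j (avg p i f) S :=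
    fun S => by simp only [diff]; ring
  simp only [hsub]
  by_cases hij : j = i
  · subst hij
    simp [diff_avg_self, expect_const]
  · rw [diff_avg_of_ne p hij, expect_sq_eq_add p i]

lemma expect_abs_diff_avg_le (hp : p ∈ Icc (0 : ℝ) 1) (i j : ι) (f : Finset ι → ℝ) :
    expect p (fun S => |diff j (avg p i f) S|) ≤ expect p (fun S => |diff j f S|) := by
  by_cases hij : j = i
  · subst hij
    simpa [diff_avg_self, expect_const] using
      expect_nonneg hp fun S => abs_nonneg (diff j f S)
  · rw [diff_avg_of_ne p hij, ← expect_avg p i (fun S => |diff j f S|)]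
    refine expect_mono hp fun S => ?_
    simp only [avg]
    refine (abs_add_le _ _).trans_eq ?_
    rw [abs_mul, abs_mul, abs_of_nonneg hp.1, abs_of_nonneg (sub_nonneg.2 hp.2)]

lemma influence_inequality_list (hp : p ∈ Icc (0 : ℝ) 1) {s : ℝ} (hs : 0 < s) (l : List ι)
    (f : Finset ι → ℝ) (hf : ∀ S, f S ∈ Icc (0 : ℝ) 1)
    (hinf : ∀ i, expect p (fun S => |diff i f S|) ≤ s ^ 4) :
    -2 * Real.log s *
        (expect p (fun S => f S ^ 2) - expect p (fun S => avgList p l f S ^ 2)) ≤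
      2 * (∑ i, expect p (fun S => diff i f S ^ 2) -
        ∑ i, expect p (fun S => diff i (avgList p l f) S ^ 2)) +
      2 * s * (l.map fun i => expect p fun S => |diff i f S|).sum := by
  induction l generalizing f with
  | nil => simp
  | cons i l ih =>
    have hd := energy_ge_of_abs_small hp hs (fun S => f S - avg p i f S) (fun S => by
        refine (abs_sub_avg_le hp i f S).trans (abs_le.2 ?_)
        have h1 := hf (insert i S)
        have h2 := hf (S.erase i)
        simp only [diff]
        constructor <;> linarith [h1.1, h1.2, h2.1, h2.2])
      ((expect_mono hp fun S => abs_sub_avg_le hp i f S).trans (hinf i))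
    have hA : ∀ S, avg p i f S ∈ Icc (0 : ℝ) 1 := fun S =>
      ⟨(avg_const p 0 i S).symm.le.trans (avg_mono hp (fun R => (hf R).1) S),
        (avg_mono hp (fun R => (hf R).2) S).trans (avg_const p 1 i S).le⟩
    have h := ih (avg p i f) hA
      fun j => (expect_abs_diff_avg_le hp i j f).trans (hinf j)
    have h3 : (l.map fun j => expect p fun S => |diff j (avg p i f) S|).sum ≤
        (l.map fun j => expect p fun S => |diff j f S|).sum :=
      List.sum_le_sum fun j _ => expect_abs_diff_avg_le hp i j f
    have h4 := expect_sq_eq_add p i f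
    have h5 : ∑ j, expect p (fun S => diff j f S ^ 2) =
        ∑ j, expect p (fun S => diff j (avg p i f) S ^ 2) +
          ∑ j, expect p (fun S => diff j (fun R => f R - avg p i f R) S ^ 2) := by
      rw [← Finset.sum_add_distrib]
      exact Finset.sum_congr rfl fun j _ => expect_sq_diff_eq_add p i j f
    have h6 : expect p (fun S => |f S - avg p i f S|) ≤ expect p (fun S => |diff i f S|) :=
      expect_mono hp fun S => abs_sub_avg_le hp i f S
    have h7 := mul_le_mul_of_nonneg_left h3 hs.le
    have h8 := mul_le_mul_of_nonneg_left h6 hs.le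
    simp only [avgList_cons, List.map_cons, List.sum_cons]
    rw [h4, h5]
    linarith

/-- If all influences of `f` are at most `s ^ 4`, then the total influence of `f` is at least of
order `log (1 / s)` times the variance of `f`. -/
lemma influence_inequality (hp : p ∈ Icc (0 : ℝ) 1) {s : ℝ} (hs : 0 < s)
    (f : Finset ι → ℝ) (hf : ∀ S, f S ∈ Icc (0 : ℝ) 1)
    (hinf : ∀ i, expect p (fun S => |diff i f S|) ≤ s ^ 4) :
    -2 * Real.log s * (expect p (fun S => f S ^ 2) - expect p f ^ 2) ≤
      2 * ∑ i, expect p (fun S => diff i f S ^ 2) +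
      2 * s * ∑ i, expect p (fun S => |diff i f S|) := by
  have h := influence_inequality_list hp hs Finset.univ.toList f hf hinf
  have h0 : ∀ i, diff i (avgList p Finset.univ.toList f) = 0 := fun i =>
    diff_avgList_eq_zero p _ f (.inl (by simp))
  simpa [h0, avgList_univ, expect_const] using h

end Influence

section Threshold

variable [DecidableEq ι] {f : Finset ι → ℝ}

lemma diff_nonneg_of_monotone (hf : Monotone f) (i : ι) (S : Finset ι) : 0 ≤ diff i f S :=
  sub_nonneg.2 (hf ((Finset.erase_subset i S).trans (Finset.subset_insert i S)))

variable [Fintype ι]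

lemma expect_mono_of_monotone (hf : Monotone f) :
    MonotoneOn (fun p => expect p f) (Icc 0 1) := by
  refine monotoneOn_of_hasDerivWithinAt_nonneg (convex_Icc 0 1)
    (fun x _ => (hasDerivAt_expect f x).continuousAt.continuousWithinAt)
    (fun x _ => (hasDerivAt_expect f x).hasDerivWithinAt) fun x hx => ?_
  exact Finset.sum_nonneg fun i _ =>
    expect_nonneg (interior_subset hx) (diff_nonneg_of_monotone hf i)

lemma influence_inequality_of_monotone (hf : Monotone f) (h01 : ∀ S, f S = 0 ∨ f S = 1)
    {p : ℝ} (hp : p ∈ Icc (0 : ℝ) 1) {s : ℝ} (hs : 0 < s) (hs1 : s ≤ 1)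
    (hinf : ∀ i, expect p (diff i f) ≤ s ^ 4) :
    -2 * Real.log s * (expect p f - expect p f ^ 2) ≤ 4 * ∑ i, expect p (diff i f) := by
  have habs : ∀ i S, |diff i f S| = diff i f S := fun i S =>
    abs_of_nonneg (diff_nonneg_of_monotone hf i S)
  have hsq : ∀ S, f S ^ 2 = f S := fun S => by rcases h01 S with h | h <;> simp [h]
  have hdsq : ∀ i S, diff i f S ^ 2 = diff i f S := fun i S => by
    have h0 := diff_nonneg_of_monotone hf i S
    simp only [diff] at *
    rcases h01 (insert i S) with h | h <;> rcases h01 (S.erase i) with h' | h' <;>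
      simp only [h, h'] at * <;> norm_num at *
  have h := influence_inequality hp hs f
    (fun S => by rcases h01 S with h | h <;> simp [h]) (by simpa only [habs] using hinf)
  simp only [habs, hsq, hdsq] at h
  have hI : 0 ≤ ∑ i, expect p (diff i f) := Finset.sum_nonneg fun i _ =>
    expect_nonneg hp (diff_nonneg_of_monotone hf i)
  refine h.trans ?_
  nlinarith [mul_le_mul_of_nonneg_right hs1 hI]

/-- Sharp threshold for an increasing event all of whose influences are at most a
proportion `1 / M` of the total influence. -/
lemma threshold_bound (hf : Monotone f) (h01 : ∀ S, f S = 0 ∨ f S = 1) {M : ℝ} (hM : 0 < M)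
    (hsymm : ∀ p ∈ Icc (0 : ℝ) 1, ∀ i, M * expect p (diff i f) ≤ ∑ j, expect p (diff j f))
    {p q : ℝ} (hp : p ∈ Icc (0 : ℝ) 1) (hq : q ∈ Icc (0 : ℝ) 1) (hpq : p < q)
    {s η : ℝ} (hs : 0 < s) (hs1 : s ≤ 1) (hsM : 1 / (q - p) ≤ M * s ^ 4)
    (hfp : 1 / 2 ≤ expect p f) (hfq : expect q f ≤ 1 - η) :
    -Real.log s * η ≤ 4 / (q - p) := by
  have hmono := expect_mono_of_monotone hf
  obtain ⟨r, hr, hslope⟩ := exists_hasDerivAt_eq_slope (fun p => expect p f)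
    (fun p => ∑ i, expect p (diff i f)) hpq
    (fun x _ => (hasDerivAt_expect f x).continuousAt.continuousWithinAt)
    (fun x _ => hasDerivAt_expect f x)
  have hr01 : r ∈ Icc (0 : ℝ) 1 := ⟨hp.1.trans hr.1.le, hr.2.le.trans hq.2⟩
  have hpr : expect p f ≤ expect r f := hmono hp hr01 hr.1.le
  have hrq : expect r f ≤ expect q f := hmono hr01 hq hr.2.le
  have hq1 : expect q f ≤ 1 := by
    rw [← expect_const (ι := ι) q 1]
    exact expect_mono hq fun S => by rcases h01 S with h | h <;> simp [h]
  have htot : ∑ i, expect r (diff i f) ≤ 1 / (q - p) := by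
    rw [hslope]
    exact div_le_div_of_nonneg_right (by linarith) (sub_pos.2 hpq).le
  have hinf := influence_inequality_of_monotone hf h01 hr01 hs hs1 fun i =>
    le_of_mul_le_mul_left ((hsymm r hr01 i).trans (htot.trans hsM)) hM
  have hlog : 0 ≤ -Real.log s := neg_nonneg.2 (Real.log_nonpos hs.le hs1)
  have hvar : η / 2 ≤ expect r f - expect r f ^ 2 := by nlinarith
  have := mul_le_mul_of_nonneg_left hvar hlog
  have h4 : 4 / (q - p) = 4 * (1 / (q - p)) := by ring
  rw [h4]
  linarith

/-- Influences are invariant under a symmetry of the function. -/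
lemma expect_diff_equiv (p : ℝ) (e : ι ≃ ι)
    (he : ∀ S : Finset ι, f (S.map e.toEmbedding) = f S) (i : ι) :
    expect p (diff (e i) f) = expect p (diff i f) := by
  rw [← expect_equiv p e]
  congr 1
  funext S
  have h := he (S.erase i)
  have h' := he (insert i S)
  rw [Finset.map_erase] at h
  rw [Finset.map_insert] at h'
  simp only [Equiv.coe_toEmbedding] at h h'
  simp only [diff, h, h']

end Threshold

end RandomSubset

section Geometry

lemma div_two_pow_eq_iff (x k a : ℕ) : x / 2 ^ k = a ↔ a * 2 ^ k ≤ x ∧ x < (a + 1) * 2 ^ k := by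
  rw [Nat.div_eq_iff (by positivity)]
  have : 0 < 2 ^ k := by positivity
  have h : (a + 1) * 2 ^ k = a * 2 ^ k + 2 ^ k := by ring
  omega

lemma le_div_two_pow_add_iff (i k : ℕ) (a u : ℝ) :
    a / 2 ^ i ≤ u / 2 ^ (i + k) ↔ a * 2 ^ k ≤ u := by
  rw [pow_add, mul_comm, ← div_div, div_le_div_iff_of_pos_right (by positivity),
    le_div_iff₀ (by positivity)]

lemma div_two_pow_add_le_iff (i k : ℕ) (a u : ℝ) :
    u / 2 ^ (i + k) ≤ a / 2 ^ i ↔ u ≤ a * 2 ^ k := by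
  rw [pow_add, mul_comm, ← div_div, div_le_div_iff_of_pos_right (by positivity),
    div_le_iff₀ (by positivity)]

/-- A dyadic interval containing the midpoint of a finer dyadic interval contains it. -/
lemma div_two_pow_eq_of_midpoint_mem {i k x a : ℕ}
    (h : ((x : ℝ) + 1 / 2) / 2 ^ (i + k) ∈ Icc ((a : ℝ) / 2 ^ i) ((a + 1) / 2 ^ i)) :
    x / 2 ^ k = a := by
  have h1 := (le_div_two_pow_add_iff i k _ _).1 h.1
  have h2 := (div_two_pow_add_le_iff i k _ _).1 h.2
  refine (div_two_pow_eq_iff x k a).2 ⟨?_, ?_⟩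
  · have : ((a * 2 ^ k : ℕ) : ℝ) < ((x + 1 : ℕ) : ℝ) := by push_cast; linarith
    exact Nat.lt_succ_iff.1 (Nat.cast_lt.1 this)
  · have : (x : ℝ) < (((a + 1) * 2 ^ k : ℕ) : ℝ) := by push_cast; linarith
    exact Nat.cast_lt.1 this

lemma Icc_subset_of_div_two_pow_eq {i k x a : ℕ} (h : x / 2 ^ k = a) :
    Icc ((x : ℝ) / 2 ^ (i + k)) ((x + 1) / 2 ^ (i + k)) ⊆
      Icc ((a : ℝ) / 2 ^ i) ((a + 1) / 2 ^ i) := by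
  obtain ⟨h1, h2⟩ := (div_two_pow_eq_iff x k a).1 h
  refine Icc_subset_Icc ((le_div_two_pow_add_iff i k _ _).2 (by exact_mod_cast h1))
    ((div_two_pow_add_le_iff i k _ _).2 (by exact_mod_cast h2))

lemma midpoint_mem_Ioo (x n : ℕ) :
    ((x : ℝ) + 1 / 2) / 2 ^ n ∈ Ioo ((x : ℝ) / 2 ^ n) ((x + 1) / 2 ^ n) :=
  ⟨div_lt_div_of_pos_right (by linarith) (by positivity),
    div_lt_div_of_pos_right (by linarith) (by positivity)⟩

lemma floor_div_two_pow_eq {i k a : ℕ} {u : ℝ}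
    (h : u ∈ Ioo ((a : ℝ) / 2 ^ i) ((a + 1) / 2 ^ i)) : ⌊u * 2 ^ (i + k)⌋₊ / 2 ^ k = a := by
  have h1 := (div_lt_iff₀ (by positivity)).1 h.1
  have h2 := (lt_div_iff₀ (by positivity)).1 h.2
  have h3 := Nat.floor_div_natCast (u * 2 ^ (i + k)) (2 ^ k)
  have h4 : u * 2 ^ (i + k) / ((2 ^ k : ℕ) : ℝ) = u * 2 ^ i := by
    push_cast
    rw [pow_add]
    field_simp
  rw [← h3, h4]
  exact (Nat.floor_eq_iff (a.cast_nonneg.trans h1.le)).2 ⟨h1.le, h2⟩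

lemma exists_mem_Icc_dyadic (n : ℕ) {u : ℝ} (hu : u ∈ Icc (0 : ℝ) 1) :
    ∃ x : ℕ, x < 2 ^ n ∧ u ∈ Icc ((x : ℝ) / 2 ^ n) ((x + 1) / 2 ^ n) := by
  have h2 : (0 : ℝ) < 2 ^ n := by positivity
  rcases hu.2.eq_or_lt with rfl | h
  · refine ⟨2 ^ n - 1, Nat.sub_lt (by positivity) one_pos, ?_⟩
    rw [Nat.cast_sub Nat.one_le_two_pow]
    push_cast
    exact ⟨(div_le_one h2).2 (by linarith), (one_le_div h2).2 (by linarith)⟩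
  · have h0 : 0 ≤ u * 2 ^ n := mul_nonneg hu.1 h2.le
    refine ⟨⌊u * 2 ^ n⌋₊, ?_, (div_le_iff₀ h2).2 (Nat.floor_le h0),
      (le_div_iff₀ h2).2 (Nat.lt_floor_add_one _).le⟩
    rw [Nat.floor_lt h0]
    push_cast
    nlinarith

/-- The tile `t` contains the square of side `2⁻ⁿ` with lower left corner `(x, y) / 2ⁿ`. -/
def Covers (n : ℕ) (t : TileIndex n) (x y : ℕ) : Prop :=
  x / 2 ^ (n - (t.1 : ℕ)) = t.2.1 ∧ y / 2 ^ (t.1 : ℕ) = t.2.2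

/-- Every square of side `2⁻ⁿ` of the grid is contained in exactly one tile of `F`. -/
def ExactCover (n : ℕ) (F : Set (TileIndex n)) : Prop :=
  ∀ x y, x < 2 ^ n → y < 2 ^ n → ∃! t, t ∈ F ∧ Covers n t x y

variable {n : ℕ}

lemma add_sub_fst (t : TileIndex n) : (t.1 : ℕ) + (n - t.1) = n :=
  Nat.add_sub_cancel' (Nat.lt_succ_iff.1 t.1.2)

lemma sub_add_fst (t : TileIndex n) : (n - t.1) + (t.1 : ℕ) = n :=
  Nat.sub_add_cancel (Nat.lt_succ_iff.1 t.1.2)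

lemma covers_of_midpoint_mem {t : TileIndex n} {x y : ℕ}
    (h : (((x : ℝ) + 1 / 2) / 2 ^ n, ((y : ℝ) + 1 / 2) / 2 ^ n) ∈ tileOf n t) :
    Covers n t x y := by
  obtain ⟨h1, h2⟩ := h
  refine ⟨div_two_pow_eq_of_midpoint_mem (i := t.1) ?_,
    div_two_pow_eq_of_midpoint_mem (i := n - t.1) ?_⟩
  · rw [add_sub_fst]; exact h1
  · rw [sub_add_fst]; exact h2

lemma Covers.prod_subset {t : TileIndex n} {x y : ℕ} (h : Covers n t x y) :
    Icc ((x : ℝ) / 2 ^ n) ((x + 1) / 2 ^ n) ×ˢ Icc ((y : ℝ) / 2 ^ n) ((y + 1) / 2 ^ n) ⊆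
      tileOf n t := by
  have h1 := Icc_subset_of_div_two_pow_eq (i := t.1) h.1
  have h2 := Icc_subset_of_div_two_pow_eq (i := n - t.1) h.2
  rw [add_sub_fst] at h1
  rw [sub_add_fst] at h2
  exact Set.prod_mono h1 h2

lemma Covers.midpoint_mem_interior {t : TileIndex n} {x y : ℕ} (h : Covers n t x y) :
    (((x : ℝ) + 1 / 2) / 2 ^ n, ((y : ℝ) + 1 / 2) / 2 ^ n) ∈ interior (tileOf n t) := by
  refine interior_mono h.prod_subset ?_
  rw [interior_prod_eq, interior_Icc, interior_Icc]
  exact ⟨midpoint_mem_Ioo x n, midpoint_mem_Ioo y n⟩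

lemma covers_floor_of_mem_interior {t : TileIndex n} {z : ℝ × ℝ}
    (h : z ∈ interior (tileOf n t)) : Covers n t ⌊z.1 * 2 ^ n⌋₊ ⌊z.2 * 2 ^ n⌋₊ := by
  rw [tileOf, dyadicTile, interior_prod_eq, interior_Icc, interior_Icc] at h
  have h1 := floor_div_two_pow_eq (k := n - t.1) h.1
  have h2 := floor_div_two_pow_eq (k := t.1) h.2
  rw [add_sub_fst] at h1
  rw [sub_add_fst] at h2
  exact ⟨h1, h2⟩

lemma Covers.lt {t : TileIndex n} {x y : ℕ} (h : Covers n t x y) : x < 2 ^ n ∧ y < 2 ^ n := by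
  have h1 := Nat.lt_mul_of_div_lt (h.1.trans_lt t.2.1.2) (by positivity)
  have h2 := Nat.lt_mul_of_div_lt (h.2.trans_lt t.2.2.2) (by positivity)
  rw [← pow_add] at h1 h2
  rw [add_sub_fst] at h1
  rw [sub_add_fst] at h2
  exact ⟨h1, h2⟩

lemma dyadic_Icc_subset {i a : ℕ} (ha : a < 2 ^ i) :
    Icc ((a : ℝ) / 2 ^ i) ((a + 1) / 2 ^ i) ⊆ Icc 0 1 :=
  Icc_subset_Icc (by positivity) ((div_le_one (by positivity)).2 (by exact_mod_cast ha))

lemma tileOf_subset_unitSquare (t : TileIndex n) : tileOf n t ⊆ unitSquare :=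
  Set.prod_mono (dyadic_Icc_subset t.2.1.2) (dyadic_Icc_subset t.2.2.2)

lemma isDyadicTile_tileOf (t : TileIndex n) : IsDyadicTile n (tileOf n t) :=
  ⟨t.1, n - t.1, t.2.1, t.2.2, add_sub_fst t, t.2.1.2, t.2.2.2, rfl⟩

/-- Tilings of the unit square are exact covers of the cells of the dyadic grid. -/
lemma tileableSquare_iff (S : Finset (TileIndex n)) :
    TileableSquare n S ↔ ∃ F : Set (TileIndex n), F ⊆ S ∧ ExactCover n F := by
  constructor
  · rintro ⟨F, hFS, -, hunion, hdisj⟩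
    choose! g hgS hg using hFS
    refine ⟨g '' F, by rintro _ ⟨t, ht, rfl⟩; exact hgS t ht, fun x y hx hy => ?_⟩
    have hmem : (((x : ℝ) + 1 / 2) / 2 ^ n, ((y : ℝ) + 1 / 2) / 2 ^ n) ∈ unitSquare :=
      ⟨dyadic_Icc_subset hx (Ioo_subset_Icc_self (midpoint_mem_Ioo x n)),
        dyadic_Icc_subset hy (Ioo_subset_Icc_self (midpoint_mem_Ioo y n))⟩
    rw [← hunion] at hmem
    obtain ⟨t, ht, hxt⟩ := hmem
    rw [hg t ht] at hxt
    have hcov := covers_of_midpoint_mem hxt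
    refine ⟨g t, ⟨⟨t, ht, rfl⟩, hcov⟩, ?_⟩
    rintro _ ⟨⟨s, hs, rfl⟩, hcov'⟩
    by_contra hne
    have h := hdisj hs ht fun hst => hne (hst ▸ rfl)
    have h1 := hcov.midpoint_mem_interior
    have h2 := hcov'.midpoint_mem_interior
    rw [← hg t ht] at h1
    rw [← hg s hs] at h2
    exact Set.eq_empty_iff_forall_notMem.1 h _ ⟨h2, h1⟩
  · rintro ⟨F, hFS, hF⟩
    refine ⟨tileOf n '' F, ?_, ?_, ?_, ?_⟩
    · rintro _ ⟨t, ht, rfl⟩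
      exact ⟨t, hFS ht, rfl⟩
    · rintro _ ⟨t, -, rfl⟩
      exact isDyadicTile_tileOf t
    · refine Set.Subset.antisymm ?_ ?_
      · rintro z ⟨_, ⟨t, -, rfl⟩, hz⟩
        exact tileOf_subset_unitSquare t hz
      · rintro z ⟨hz1, hz2⟩
        obtain ⟨x, hx, hzx⟩ := exists_mem_Icc_dyadic n hz1
        obtain ⟨y, hy, hzy⟩ := exists_mem_Icc_dyadic n hz2
        obtain ⟨t, ⟨htF, ht⟩, -⟩ := hF x y hx hy
        exact ⟨_, ⟨t, htF, rfl⟩, ht.prod_subset ⟨hzx, hzy⟩⟩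
    · rintro _ ⟨s, hs, rfl⟩ _ ⟨t, ht, rfl⟩ hst
      refine Set.eq_empty_iff_forall_notMem.2 fun z hz => hst ?_
      have h1 := covers_floor_of_mem_interior hz.1
      have h2 := covers_floor_of_mem_interior hz.2
      rw [(hF _ _ h1.lt.1 h1.lt.2).unique ⟨hs, h1⟩ ⟨ht, h2⟩]

end Geometry

section Symmetry

variable {n : ℕ}

lemma TileIndex.ext_val {s t : TileIndex n} (h : (s.1 : ℕ) = t.1) (h1 : (s.2.1 : ℕ) = t.2.1)
    (h2 : (s.2.2 : ℕ) = t.2.2) : s = t := by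
  obtain ⟨i, a, b⟩ := s
  obtain ⟨i', a', b'⟩ := t
  obtain rfl : i = i' := Fin.ext h
  obtain rfl : a = a' := Fin.ext h1
  obtain rfl : b = b' := Fin.ext h2
  rfl

lemma shiftRight_lt {u k i n : ℕ} (h : i + k = n) (hu : u < 2 ^ n) : u >>> k < 2 ^ i := by
  rw [Nat.shiftRight_eq_div_pow]
  exact Nat.div_lt_of_lt_mul (by rwa [← pow_add, add_comm, h])

/-- Action on tiles of the exclusive or with `(u, v)` on the grid of cells. -/
def xorTile (n : ℕ) (u v : Fin (2 ^ n)) (t : TileIndex n) : TileIndex n :=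
  ⟨t.1, ⟨t.2.1 ^^^ ((u : ℕ) >>> (n - (t.1 : ℕ))),
      Nat.xor_lt_two_pow t.2.1.2 (shiftRight_lt (add_sub_fst t) u.2)⟩,
    ⟨t.2.2 ^^^ ((v : ℕ) >>> (t.1 : ℕ)),
      Nat.xor_lt_two_pow t.2.2.2 (shiftRight_lt (sub_add_fst t) v.2)⟩⟩

lemma xorTile_involutive (u v : Fin (2 ^ n)) : Function.Involutive (xorTile n u v) := fun t =>
  TileIndex.ext_val rfl (by simp [xorTile]) (by simp [xorTile])

/-- `xorTile` as a permutation of the tiles. -/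
def xorPerm (n : ℕ) (u v : Fin (2 ^ n)) : Equiv.Perm (TileIndex n) :=
  (xorTile_involutive u v).toPerm

lemma xor_div_two_pow_eq_iff (x u k a : ℕ) :
    (x ^^^ u) / 2 ^ k = a ^^^ (u >>> k) ↔ x / 2 ^ k = a := by
  rw [← Nat.shiftRight_eq_div_pow, Nat.shiftRight_xor_distrib, Nat.xor_left_inj,
    Nat.shiftRight_eq_div_pow]

lemma covers_xorPerm {u v : Fin (2 ^ n)} {t : TileIndex n} {x y : ℕ} :
    Covers n (xorPerm n u v t) (x ^^^ u) (y ^^^ v) ↔ Covers n t x y :=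
  and_congr (xor_div_two_pow_eq_iff x u _ _) (xor_div_two_pow_eq_iff y v _ _)

lemma TileableSquare.map_xorPerm {S : Finset (TileIndex n)} (h : TileableSquare n S)
    (u v : Fin (2 ^ n)) : TileableSquare n (S.map (xorPerm n u v).toEmbedding) := by
  rw [tileableSquare_iff] at h ⊢
  obtain ⟨F, hFS, hF⟩ := h
  refine ⟨xorPerm n u v '' F, ?_, fun x y hx hy => ?_⟩
  · rw [Finset.coe_map]
    exact Set.image_mono hFS
  · obtain ⟨t, ⟨htF, ht⟩, huniq⟩ := hF (x ^^^ u) (y ^^^ v) (Nat.xor_lt_two_pow hx u.2)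
      (Nat.xor_lt_two_pow hy v.2)
    have hcov : ∀ s, Covers n (xorPerm n u v s) x y ↔ Covers n s (x ^^^ u) (y ^^^ v) := by
      intro s
      have h : xorPerm n u v (xorPerm n u v s) = s := xorTile_involutive u v s
      rw [← covers_xorPerm (u := u) (v := v), h]
    refine ⟨xorPerm n u v t, ⟨⟨t, htF, rfl⟩, (hcov t).2 ht⟩, ?_⟩
    rintro _ ⟨⟨s, hs, rfl⟩, hs'⟩
    rw [huniq s ⟨hs, (hcov s).1 hs'⟩]

lemma tileableSquare_map_xorPerm (S : Finset (TileIndex n)) (u v : Fin (2 ^ n)) :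
    TileableSquare n (S.map (xorPerm n u v).toEmbedding) ↔ TileableSquare n S := by
  refine ⟨fun h => ?_, fun h => h.map_xorPerm u v⟩
  have h' := h.map_xorPerm u v
  rw [Finset.map_map] at h'
  convert h'
  ext t
  simp [xorPerm, xorTile_involutive u v _]

lemma shiftLeft_lt {w k i n : ℕ} (h : i + k = n) (hw : w < 2 ^ i) : w <<< k < 2 ^ n := by
  rw [Nat.shiftLeft_eq, ← h, pow_add]
  exact Nat.mul_lt_mul_of_pos_right hw (by positivity)

/-- The symmetries of the grid act transitively on the tiles of a given shape. -/
lemma exists_xorPerm_eq (i : Fin (n + 1)) (c d : Fin (2 ^ (i : ℕ)) × Fin (2 ^ (n - (i : ℕ)))) :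
    ∃ u v : Fin (2 ^ n), xorPerm n u v ⟨i, c⟩ = ⟨i, d⟩ := by
  refine ⟨⟨(c.1 ^^^ d.1 : ℕ) <<< (n - i), shiftLeft_lt (add_sub_fst ⟨i, c⟩)
      (Nat.xor_lt_two_pow c.1.2 d.1.2)⟩,
    ⟨(c.2 ^^^ d.2 : ℕ) <<< (i : ℕ), shiftLeft_lt (sub_add_fst ⟨i, c⟩)
      (Nat.xor_lt_two_pow c.2.2 d.2.2)⟩, TileIndex.ext_val rfl ?_ ?_⟩ <;>
  simp [xorPerm, xorTile, Nat.shiftLeft_shiftRight]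

end Symmetry

section Recursion

variable {n : ℕ}

/-- The tile of order `n + 1` obtained by mapping the unit square to its left (`c = 0`) or
right (`c = 1`) half. -/
def vHalf (c : Fin 2) (t : TileIndex n) : TileIndex (n + 1) :=
  ⟨⟨t.1 + 1, by omega⟩, ⟨t.2.1 + c * 2 ^ (t.1 : ℕ), by
      have h := t.2.1.2
      have hc : (c : ℕ) * 2 ^ (t.1 : ℕ) ≤ 1 * 2 ^ (t.1 : ℕ) :=
        Nat.mul_le_mul_right _ (Nat.lt_succ_iff.1 c.2)
      simp only [pow_succ]
      omega⟩,
    ⟨t.2.2, by simp only [Nat.add_sub_add_right]; exact t.2.2.2⟩⟩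

/-- The tile of order `n + 1` obtained by mapping the unit square to its lower (`c = 0`) or
upper (`c = 1`) half. -/
def hHalf (c : Fin 2) (t : TileIndex n) : TileIndex (n + 1) :=
  ⟨⟨t.1, by omega⟩, ⟨t.2.1, t.2.1.2⟩, ⟨t.2.2 + c * 2 ^ (n - (t.1 : ℕ)), by
      have h := t.2.2.2
      have hc : (c : ℕ) * 2 ^ (n - (t.1 : ℕ)) ≤ 1 * 2 ^ (n - (t.1 : ℕ)) :=
        Nat.mul_le_mul_right _ (Nat.lt_succ_iff.1 c.2)
      simp only [Nat.sub_add_comm (Nat.lt_succ_iff.1 t.1.2), pow_succ]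
      omega⟩⟩

lemma add_mul_inj_of_lt {a a' m m' : ℕ} (hm : m = m') (ha : a < m) (ha' : a' < m')
    {c c' : Fin 2} (h : a + c * m = a' + c' * m') : c = c' ∧ a = a' := by
  subst hm
  fin_cases c <;> fin_cases c' <;> simp at h ⊢ <;> omega

lemma vHalf_inj {c c' : Fin 2} {s t : TileIndex n} (h : vHalf c s = vHalf c' t) :
    c = c' ∧ s = t := by
  have h0 : (s.1 : ℕ) = t.1 := Nat.succ_injective (congrArg (fun r => (r.1 : ℕ)) h)
  have h1 : (s.2.1 : ℕ) + c * 2 ^ (s.1 : ℕ) = t.2.1 + c' * 2 ^ (t.1 : ℕ) :=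
    congrArg (fun r => (r.2.1 : ℕ)) h
  have h2 : (s.2.2 : ℕ) = t.2.2 := congrArg (fun r => (r.2.2 : ℕ)) h
  obtain ⟨hc, ha⟩ := add_mul_inj_of_lt (by rw [h0]) s.2.1.2 t.2.1.2 h1
  exact ⟨hc, TileIndex.ext_val h0 ha h2⟩

lemma hHalf_inj {c c' : Fin 2} {s t : TileIndex n} (h : hHalf c s = hHalf c' t) :
    c = c' ∧ s = t := by
  have h0 : (s.1 : ℕ) = t.1 := congrArg (fun r => (r.1 : ℕ)) h
  have h1 : (s.2.1 : ℕ) = t.2.1 := congrArg (fun r => (r.2.1 : ℕ)) h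
  have h2 : (s.2.2 : ℕ) + c * 2 ^ (n - (s.1 : ℕ)) = t.2.2 + c' * 2 ^ (n - (t.1 : ℕ)) :=
    congrArg (fun r => (r.2.2 : ℕ)) h
  obtain ⟨hc, hb⟩ := add_mul_inj_of_lt (by rw [h0]) s.2.2.2 t.2.2.2 h2
  exact ⟨hc, TileIndex.ext_val h0 h1 hb⟩

lemma add_mul_two_pow_div (x c i k : ℕ) :
    (x + c * 2 ^ (i + k)) / 2 ^ k = x / 2 ^ k + c * 2 ^ i := by
  rw [pow_add, ← mul_assoc, Nat.add_mul_div_right _ _ (by positivity)]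

lemma two_mul_div_two_pow_succ (y i : ℕ) : 2 * y / 2 ^ (i + 1) = y / 2 ^ i := by
  rw [pow_succ', Nat.mul_div_mul_left _ _ two_pos]

lemma covers_vHalf {c : Fin 2} {t : TileIndex n} {x y : ℕ} :
    Covers (n + 1) (vHalf c t) (x + c * 2 ^ n) (2 * y) ↔ Covers n t x y := by
  have h := add_mul_two_pow_div x c t.1 (n - t.1)
  rw [add_sub_fst] at h
  simp only [Covers, vHalf, Nat.add_sub_add_right, h, two_mul_div_two_pow_succ,
    Nat.add_right_cancel_iff]

lemma covers_hHalf {c : Fin 2} {t : TileIndex n} {x y : ℕ} :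
    Covers (n + 1) (hHalf c t) (2 * x) (y + c * 2 ^ n) ↔ Covers n t x y := by
  have h := add_mul_two_pow_div y c (n - t.1) t.1
  rw [sub_add_fst] at h
  simp only [Covers, hHalf, Nat.sub_add_comm (Nat.lt_succ_iff.1 t.1.2), h,
    two_mul_div_two_pow_succ, Nat.add_right_cancel_iff]

lemma Covers.eq_of_shape_eq {s t : TileIndex n} {x y : ℕ} (hs : Covers n s x y)
    (ht : Covers n t x y) (h : (s.1 : ℕ) = t.1) : s = t :=
  TileIndex.ext_val h (by rw [← hs.1, ← ht.1, h]) (by rw [← hs.2, ← ht.2, h])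

lemma exists_covers {i x y : ℕ} (hi : i ≤ n) (hx : x < 2 ^ n) (hy : y < 2 ^ n) :
    ∃ t : TileIndex n, (t.1 : ℕ) = i ∧ Covers n t x y := by
  refine ⟨⟨⟨i, Nat.lt_succ_of_le hi⟩, ⟨x / 2 ^ (n - i), ?_⟩, ⟨y / 2 ^ i, ?_⟩⟩, rfl, rfl, rfl⟩
  · exact Nat.div_lt_of_lt_mul (by rwa [← pow_add, Nat.sub_add_cancel hi])
  · exact Nat.div_lt_of_lt_mul (by rwa [← pow_add, Nat.add_sub_cancel' hi])

lemma add_mul_two_pow_lt {x : ℕ} (c : Fin 2) (hx : x < 2 ^ n) : x + c * 2 ^ n < 2 ^ (n + 1) := by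
  have hc : (c : ℕ) * 2 ^ n ≤ 1 * 2 ^ n := Nat.mul_le_mul_right _ (Nat.lt_succ_iff.1 c.2)
  rw [pow_succ]
  omega

lemma ExactCover.vHalf {F : Set (TileIndex (n + 1))} (hF : ExactCover (n + 1) F)
    (h0 : ∀ s ∈ F, (s.1 : ℕ) ≠ 0) (c : Fin 2) : ExactCover n {t | vHalf c t ∈ F} := by
  intro x y hx hy
  obtain ⟨s, ⟨hsF, hs⟩, huniq⟩ := hF (x + c * 2 ^ n) (2 * y) (add_mul_two_pow_lt c hx)
    (by rw [pow_succ]; omega)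
  have hs0 := h0 s hsF
  obtain ⟨t, hti, ht⟩ := exists_covers (i := s.1 - 1) (n := n) (by omega) hx hy
  have hst : s = _root_.vHalf c t := hs.eq_of_shape_eq (covers_vHalf.2 ht) (by
    change (s.1 : ℕ) = t.1 + 1
    omega)
  refine ⟨t, ⟨show _root_.vHalf c t ∈ F from hst ▸ hsF, ht⟩, fun r hr => ?_⟩
  exact (vHalf_inj ((huniq _ ⟨hr.1, covers_vHalf.2 hr.2⟩).trans hst)).2

lemma ExactCover.hHalf {F : Set (TileIndex (n + 1))} (hF : ExactCover (n + 1) F)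
    (h0 : ∀ s ∈ F, (s.1 : ℕ) ≠ n + 1) (c : Fin 2) : ExactCover n {t | hHalf c t ∈ F} := by
  intro x y hx hy
  obtain ⟨s, ⟨hsF, hs⟩, huniq⟩ := hF (2 * x) (y + c * 2 ^ n) (by rw [pow_succ]; omega)
    (add_mul_two_pow_lt c hy)
  have hs0 := h0 s hsF
  obtain ⟨t, hti, ht⟩ := exists_covers (i := s.1) (n := n) (by omega) hx hy
  have hst : s = _root_.hHalf c t := hs.eq_of_shape_eq (covers_hHalf.2 ht) hti.symm
  refine ⟨t, ⟨show _root_.hHalf c t ∈ F from hst ▸ hsF, ht⟩, fun r hr => ?_⟩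
  exact (hHalf_inj ((huniq _ ⟨hr.1, covers_hHalf.2 hr.2⟩).trans hst)).2

/-- A tiling cannot contain both a tile of full width and a tile of full height. -/
lemma ExactCover.shape_ne {F : Set (TileIndex (n + 1))} (hF : ExactCover (n + 1) F) :
    (∀ s ∈ F, (s.1 : ℕ) ≠ 0) ∨ ∀ s ∈ F, (s.1 : ℕ) ≠ n + 1 := by
  by_contra! h
  obtain ⟨⟨s, hs, hs0⟩, ⟨t, ht, htn⟩⟩ := h
  have hsb : (s.2.2 : ℕ) < 2 ^ (n + 1) := by simpa [hs0] using s.2.2.2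
  have hta : (t.2.1 : ℕ) < 2 ^ (n + 1) := by simpa [htn] using t.2.1.2
  have hsa : (s.2.1 : ℕ) < 1 := by simpa [hs0] using s.2.1.2
  have htb : (t.2.2 : ℕ) < 1 := by simpa [htn] using t.2.2.2
  have h := (hF t.2.1 s.2.2 hta hsb).unique ⟨hs, by
    have e : (t.2.1 : ℕ) / 2 ^ (n + 1 - (s.1 : ℕ)) = 0 :=
      Nat.div_eq_of_lt (hta.trans_eq (by rw [hs0, Nat.sub_zero]))
    exact ⟨e.trans (by omega), by simp [hs0]⟩⟩ ⟨ht, by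
    have e : (s.2.2 : ℕ) / 2 ^ (t.1 : ℕ) = 0 := Nat.div_eq_of_lt (hsb.trans_eq (by rw [htn]))
    exact ⟨by simp [htn], e.trans (by omega)⟩⟩
  rw [← h] at htn
  omega

lemma TileableSquare.halves {S : Finset (TileIndex (n + 1))} (h : TileableSquare (n + 1) S) :
    (∀ c, TileableSquare n {t | vHalf c t ∈ S}) ∨ ∀ c, TileableSquare n {t | hHalf c t ∈ S} := by
  obtain ⟨F, hFS, hF⟩ := (tileableSquare_iff S).1 h
  refine hF.shape_ne.imp (fun h0 c => ?_) fun h0 c => ?_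
  · exact (tileableSquare_iff _).2 ⟨_, fun t ht => by simpa using hFS ht, hF.vHalf h0 c⟩
  · exact (tileableSquare_iff _).2 ⟨_, fun t ht => by simpa using hFS ht, hF.hHalf h0 c⟩

lemma tileableSquare_univ (n : ℕ) : TileableSquare n Finset.univ := by
  refine (tileableSquare_iff _).2 ⟨{t | (t.1 : ℕ) = 0}, by simp, fun x y hx hy => ?_⟩
  obtain ⟨t, ht0, ht⟩ := exists_covers (Nat.zero_le n) hx hy
  exact ⟨t, ⟨ht0, ht⟩, fun s hs => hs.2.eq_of_shape_eq ht (hs.1.trans ht0.symm)⟩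

lemma TileableSquare.mono {S R : Finset (TileIndex n)} (hSR : S ⊆ R) (h : TileableSquare n S) :
    TileableSquare n R := by
  obtain ⟨F, hF, hF'⟩ := h
  exact ⟨F, fun t ht => (hF t ht).imp fun x hx => ⟨hSR hx.1, hx.2⟩, hF'⟩

end Recursion

section Probability

open RandomSubset

open Classical in
/-- The indicator function of the event that the unit square can be tiled. -/
def tileableIndicator (n : ℕ) (S : Finset (TileIndex n)) : ℝ :=
  if TileableSquare n S then 1 else 0

variable {n : ℕ} {p : ℝ}

lemma tileableIndicator_eq_zero_or_one (S : Finset (TileIndex n)) :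
    tileableIndicator n S = 0 ∨ tileableIndicator n S = 1 := by
  unfold tileableIndicator
  split_ifs <;> simp

lemma tileableIndicator_nonneg (S : Finset (TileIndex n)) : 0 ≤ tileableIndicator n S := by
  rcases tileableIndicator_eq_zero_or_one S with h | h <;> simp [h]

lemma tileableIndicator_le_one (S : Finset (TileIndex n)) : tileableIndicator n S ≤ 1 := by
  rcases tileableIndicator_eq_zero_or_one S with h | h <;> simp [h]

lemma monotone_tileableIndicator : Monotone (tileableIndicator n) := by
  intro S R hSR
  by_cases h : TileableSquare n S
  · simp [tileableIndicator, h, h.mono hSR]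
  · simpa [tileableIndicator, h] using tileableIndicator_nonneg R

lemma card_shape (i : Fin (n + 1)) :
    Fintype.card (Fin (2 ^ (i : ℕ)) × Fin (2 ^ (n - (i : ℕ)))) = 2 ^ n := by
  rw [Fintype.card_prod, Fintype.card_fin, Fintype.card_fin, ← pow_add,
    Nat.add_sub_cancel' (Nat.lt_succ_iff.1 i.2)]

lemma card_tileIndex (n : ℕ) : Fintype.card (TileIndex n) = (n + 1) * 2 ^ n := by
  rw [Fintype.card_sigma, Finset.sum_congr rfl fun i _ => card_shape i]
  simp

lemma T_eq_expect (n : ℕ) (p : ℝ) : T n p = expect p (tileableIndicator n) := by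
  simp only [T, Pr, expect, card_tileIndex, tileableIndicator, mul_ite, mul_one, mul_zero]

lemma T_nonneg (hp : p ∈ Icc (0 : ℝ) 1) : 0 ≤ T n p := by
  rw [T_eq_expect]
  exact expect_nonneg hp tileableIndicator_nonneg

lemma T_le_one (hp : p ∈ Icc (0 : ℝ) 1) : T n p ≤ 1 := by
  rw [T_eq_expect, ← expect_const (ι := TileIndex n) p 1]
  exact expect_mono hp tileableIndicator_le_one

lemma T_monotoneOn (n : ℕ) : MonotoneOn (T n) (Icc 0 1) := by
  have : T n = fun p => expect p (tileableIndicator n) := funext (T_eq_expect n)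
  rw [this]
  exact expect_mono_of_monotone monotone_tileableIndicator

lemma T_one (n : ℕ) : T n 1 = 1 := by
  rw [T_eq_expect, expect, Finset.sum_eq_single Finset.univ]
  · simp [tileableIndicator, tileableSquare_univ]
  · intro S _ hS
    have := (Finset.card_lt_iff_ne_univ S).2 hS
    rw [sub_self, zero_pow (Nat.sub_ne_zero_of_lt this), mul_zero, zero_mul]
  · simp

lemma expect_halves (φ : Fin 2 → TileIndex n → TileIndex (n + 1))
    (hφ : ∀ {c c' s t}, φ c s = φ c' t → c = c' ∧ s = t) :
    expect p (fun S => tileableIndicator n {t | φ 0 t ∈ S} *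
      tileableIndicator n {t | φ 1 t ∈ S}) = T n p ^ 2 := by
  rw [T_eq_expect, sq]
  refine expect_mul_of_disjoint p (Sum.elim (φ 0) (φ 1)) ?_ _ _
  rintro (s | s) (t | t) h
  · exact congrArg _ (hφ h).2
  · exact absurd (hφ h).1 (by simp)
  · exact absurd (hφ h).1 (by simp)
  · exact congrArg _ (hφ h).2

/-- The first cut of a tiling is vertical or horizontal. -/
lemma T_succ_le (hp : p ∈ Icc (0 : ℝ) 1) : T (n + 1) p ≤ 2 * T n p ^ 2 := by
  rw [two_mul]
  nth_rewrite 1 [← expect_halves vHalf vHalf_inj]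
  rw [← expect_halves hHalf hHalf_inj, ← expect_add, T_eq_expect]
  refine expect_mono hp fun S => ?_
  have hv := mul_nonneg (tileableIndicator_nonneg (n := n) {t | vHalf 0 t ∈ S})
    (tileableIndicator_nonneg {t | vHalf 1 t ∈ S})
  have hh := mul_nonneg (tileableIndicator_nonneg (n := n) {t | hHalf 0 t ∈ S})
    (tileableIndicator_nonneg {t | hHalf 1 t ∈ S})
  by_cases h : TileableSquare (n + 1) S
  · have h1 := tileableIndicator_le_one S
    rcases h.halves with h | h
    · refine h1.trans (le_add_of_le_of_nonneg ?_ hh)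
      simp [tileableIndicator, h]
    · refine h1.trans (le_add_of_nonneg_of_le hv ?_)
      simp [tileableIndicator, h]
  · rw [tileableIndicator, if_neg h]
    exact add_nonneg hv hh

lemma card_mul_le_sum_sigma {α : Type*} {β : α → Type*} [Fintype α] [∀ a, Fintype (β a)]
    {g : (Σ a, β a) → ℝ} (h0 : ∀ s, 0 ≤ g s) {a : α} {b : β a} (h : ∀ d, g ⟨a, d⟩ = g ⟨a, b⟩) :
    Fintype.card (β a) * g ⟨a, b⟩ ≤ ∑ s, g s := by
  calc Fintype.card (β a) * g ⟨a, b⟩ = ∑ d, g ⟨a, d⟩ := by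
        rw [Finset.sum_congr rfl fun d _ => h d, Finset.sum_const, Finset.card_univ, nsmul_eq_mul]
    _ ≤ ∑ a, ∑ d, g ⟨a, d⟩ :=
        Finset.single_le_sum (f := fun a => ∑ d, g ⟨a, d⟩)
          (fun j _ => Finset.sum_nonneg fun d _ => h0 ⟨j, d⟩) (Finset.mem_univ a)
    _ = _ := (Fintype.sum_sigma g).symm

lemma two_pow_mul_influence_le (hp : p ∈ Icc (0 : ℝ) 1) (t : TileIndex n) :
    2 ^ n * expect p (diff t (tileableIndicator n)) ≤
      ∑ s, expect p (diff s (tileableIndicator n)) := by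
  obtain ⟨i, c⟩ := t
  have hinv : ∀ (u v : Fin (2 ^ n)) (S : Finset (TileIndex n)),
      tileableIndicator n (S.map (xorPerm n u v).toEmbedding) = tileableIndicator n S :=
    fun u v S => by
      by_cases h : TileableSquare n S
      · rw [tileableIndicator, tileableIndicator, if_pos h, if_pos (h.map_xorPerm u v)]
      · rw [tileableIndicator, tileableIndicator, if_neg h,
          if_neg (mt (tileableSquare_map_xorPerm S u v).1 h)]
  have h0 : ∀ s, 0 ≤ expect p (diff s (tileableIndicator n)) := fun s =>
    expect_nonneg hp (diff_nonneg_of_monotone monotone_tileableIndicator s)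
  have h : ∀ d, expect p (diff ⟨i, d⟩ (tileableIndicator n)) =
      expect p (diff ⟨i, c⟩ (tileableIndicator n)) := fun d => by
    obtain ⟨u, v, huv⟩ := exists_xorPerm_eq i c d
    rw [← huv]
    exact expect_diff_equiv p (xorPerm n u v) (hinv u v) _
  have hsum := card_mul_le_sum_sigma h0 h
  rw [card_shape, Nat.cast_pow, Nat.cast_ofNat] at hsum
  exact hsum

lemma tendsto_T_zero_of_lt_half (hp : p ∈ Icc (0 : ℝ) 1) {m : ℕ} (hm : T m p < 1 / 2) :
    Tendsto (fun n => T n p) atTop (𝓝 0) := by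
  have h0 : 0 ≤ T m p := T_nonneg hp
  have hbound : ∀ k, T (k + m) p ≤ (2 * T m p) ^ k * T m p := by
    intro k
    induction k with
    | zero => simp
    | succ k ih =>
      have hk0 : 0 ≤ T (k + m) p := T_nonneg hp
      have hle : T (k + m) p ≤ T m p :=
        ih.trans (mul_le_of_le_one_left h0 (pow_le_one₀ (by linarith) (by linarith)))
      have hrec : T (k + 1 + m) p ≤ 2 * T (k + m) p ^ 2 := by
        rw [add_right_comm]
        exact T_succ_le hp
      calc T (k + 1 + m) p ≤ 2 * T m p * T (k + m) p := by nlinarith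
        _ ≤ 2 * T m p * ((2 * T m p) ^ k * T m p) :=
          mul_le_mul_of_nonneg_left ih (by linarith)
        _ = _ := by ring
  refine (tendsto_add_atTop_iff_nat m).1 (squeeze_zero (fun k => T_nonneg hp) hbound ?_)
  simpa using (tendsto_pow_atTop_nhds_zero_of_lt_one (r := 2 * T m p) (by linarith)
    (by linarith)).mul_const (T m p)

lemma tendsto_T_one_of_half_le {q : ℝ} (hp : p ∈ Icc (0 : ℝ) 1) (hq : q ∈ Icc (0 : ℝ) 1)
    (hpq : p < q) (h : ∀ m, 1 / 2 ≤ T m p) : Tendsto (fun n => T n q) atTop (𝓝 1) := by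
  refine tendsto_order.2 ⟨fun a ha => ?_, fun a ha =>
    Eventually.of_forall fun n => (T_le_one hq).trans_lt ha⟩
  have hη : 0 < 1 - a := sub_pos.2 ha
  have hd : 0 < q - p := sub_pos.2 hpq
  set s := Real.exp (-(4 / (q - p) / (1 - a) + 1)) with hs
  have hs0 : 0 < s := Real.exp_pos _
  have hs1 : s ≤ 1 := by
    rw [hs, Real.exp_le_one_iff, neg_nonpos]
    positivity
  have hlog : 4 / (q - p) < -Real.log s * (1 - a) := by
    rw [hs, Real.log_exp, neg_neg, add_mul, div_mul_cancel₀ _ hη.ne']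
    linarith
  have hlarge : Tendsto (fun n : ℕ => (2 : ℝ) ^ n * s ^ 4) atTop atTop :=
    (tendsto_pow_atTop_atTop_of_one_lt one_lt_two).atTop_mul_const (by positivity)
  filter_upwards [hlarge.eventually_ge_atTop (1 / (q - p))] with n hn
  by_contra! hle
  refine absurd (threshold_bound monotone_tileableIndicator tileableIndicator_eq_zero_or_one
    (M := 2 ^ n) (by positivity) (fun r hr t => two_pow_mul_influence_le hr t) hp hq hpq hs0 hs1
    hn ?_ (η := 1 - a) ?_) hlog.not_ge
  · rw [← T_eq_expect]
    exact h n
  · rw [← T_eq_expect]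
    linarith

end Probability

/-- sharp threshold at `p_c`: for `p ∈ [0,1]`, if `p < p_c` then
`T_n(p) → 0`, and if `p > p_c` then `T_n(p) → 1`. -/
theorem sharp_threshold (p : ℝ) (hp : p ∈ Set.Icc (0 : ℝ) 1) :
    (p < pc → Tendsto (fun n => T n p) atTop (𝓝 0)) ∧
    (pc < p → Tendsto (fun n => T n p) atTop (𝓝 1)) := by
  have hbdd : BddBelow {p : ℝ | p ∈ Set.Icc (0 : ℝ) 1 ∧ Tendsto (fun n => T n p) atTop (𝓝 1)} :=
    ⟨0, fun x hx => hx.1.1⟩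
  have hone : (1 : ℝ) ∈
      {p : ℝ | p ∈ Set.Icc (0 : ℝ) 1 ∧ Tendsto (fun n => T n p) atTop (𝓝 1)} :=
    ⟨⟨zero_le_one, le_rfl⟩, by simp [T_one]⟩
  refine ⟨fun hlt => ?_, fun hlt => ?_⟩
  · have hpc1 : pc ≤ 1 := csInf_le hbdd hone
    by_contra hnot
    have hhalf : ∀ m, 1 / 2 ≤ T m p := fun m => by
      by_contra! h
      exact hnot (tendsto_T_zero_of_lt_half hp h)
    obtain ⟨q, hpq, hqpc⟩ := exists_between hlt
    have hq : q ∈ Icc (0 : ℝ) 1 := ⟨hp.1.trans hpq.le, hqpc.le.trans hpc1⟩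
    have : pc ≤ q := csInf_le hbdd ⟨hq, tendsto_T_one_of_half_le hp hq hpq hhalf⟩
    exact absurd hqpc this.not_gt
  · obtain ⟨q, ⟨hq, hqT⟩, hqp⟩ := exists_lt_of_csInf_lt ⟨1, hone⟩ hlt
    exact tendsto_of_tendsto_of_tendsto_of_le_of_le hqT tendsto_const_nhds
      (fun n => T_monotoneOn n hq hp hqp.le) fun n => T_le_one hp

end
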